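/- Let d ≥ 1 and let f be a probability density on the torus [0,1]^d (nonnegative, measurable, extended 1-periodically to ℝ^d, with ∫_{[0,1]^d} f = 1), with associated probability measure μ. Define the maximal function M(x) = sup_{0 < ρ ≤ 1/2} λ(B(x,ρ)) / μ(B(x,ρ)), where B(x,ρ) is the closed ball of radius ρ in the torus metric and λ is Lebesgue measure. Then there exists a constant C depending only on d such that ∫_{[0,1]^d} ln^2( M(x) + 1 ) f(x) dx ≤ C. -/

import Mathlib

open MeasureTheory Real

noncomputable section

abbrev Euc (d : ℕ) : Type := EuclideanSpace ℝ (Fin d)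

/-- The unit cube `[0,1]^d`. -/
def unitCube (d : ℕ) : Set (Euc d) := {x | ∀ i, x i ∈ Set.Icc (0:ℝ) 1}

/-- Volume of the unit Euclidean ball in `ℝ^d`. -/
def unitBallVol (d : ℕ) : ℝ := Real.pi ^ ((d : ℝ) / 2) / Real.Gamma (1 + (d : ℝ) / 2)

/-- The point of `ℝ^d` with integer coordinates `m`. -/
def intVec (d : ℕ) (m : Fin d → ℤ) : Euc d :=
  (WithLp.equiv 2 (Fin d → ℝ)).symm fun i => (m i : ℝ)

/-- Torus distance: `d(x,y) = min_{m ∈ ℤ^d} ‖x + m - y‖`. -/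
def torusDist (d : ℕ) (x y : Euc d) : ℝ :=
  ⨅ m : Fin d → ℤ, ‖x + intVec d m - y‖

/-- `(s,L)`-Hölder condition for `s ∈ (0,2]`. -/
def IsHolderOrder (d : ℕ) (s L : ℝ) (f : Euc d → ℝ) : Prop :=
  if s ≤ 1 then
    ∀ x y : Euc d, |f x - f y| ≤ L * ‖x - y‖ ^ s
  else
    ContDiff ℝ 1 f ∧ ∀ x y : Euc d, ‖gradient f x - gradient f y‖ ≤ L * ‖x - y‖ ^ (s - 1)

/-- `f` is 1-periodic in each coordinate. -/
def IsPeriodic (d : ℕ) (f : Euc d → ℝ) : Prop :=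
  ∀ (x : Euc d) (i : Fin d), f (x + EuclideanSpace.single i 1) = f x

/-- Probability density in the Hölder ball `H^s_d(L;[0,1]^d)`, represented by its
1-periodic extension to `ℝ^d`. -/
def HolderDensity (d : ℕ) (s L : ℝ) (f : Euc d → ℝ) : Prop :=
  IsHolderOrder d s L f ∧ IsPeriodic d f ∧ (∀ x, 0 ≤ f x) ∧
    (∫ x in unitCube d, f x) = 1

/-- The probability measure on `[0,1]^d` with density `f`. -/
def densityMeasure (d : ℕ) (f : Euc d → ℝ) : Measure (Euc d) :=
  (volume.restrict (unitCube d)).withDensity fun x => ENNReal.ofReal (f x)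

/-- Law of `n` i.i.d. samples from density `f`. -/
def sampleMeasure (d n : ℕ) (f : Euc d → ℝ) : Measure (Fin n → Euc d) :=
  Measure.pi fun _ => densityMeasure d f

/-- The `k`-th smallest element (1-indexed) of a multiset of reals. -/
def kthSmallest (s : Multiset ℝ) (k : ℕ) : ℝ :=
  (s.sort (· ≤ ·)).getD (k - 1) 0

/-- `R_{i,k}`: the `k`-nearest neighbor torus distance from `X i` to the other points. -/
def nnDist (d n : ℕ) (X : Fin n → Euc d) (i : Fin n) (k : ℕ) : ℝ :=
  kthSmallest ((Finset.univ.erase i).val.map fun j => torusDist d (X i) (X j)) k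

/-- The digamma function: derivative of `ln Γ`. -/
def digamma (x : ℝ) : ℝ := deriv (fun y => Real.log (Real.Gamma y)) x

/-- The Kozachenko–Leonenko `k`-nearest neighbor differential entropy estimator. -/
def klEstimator (d k n : ℕ) (X : Fin n → Euc d) : ℝ :=
  Real.log k - digamma k +
    (1 / n : ℝ) * ∑ i : Fin n, Real.log ((n / k : ℝ) * (unitBallVol d * nnDist d n X i k ^ d))

/-- Differential entropy `h(f) = -∫_{[0,1]^d} f ln f`. -/
def diffEntropy (d : ℕ) (f : Euc d → ℝ) : ℝ :=
  -∫ x in unitCube d, f x * Real.log (f x)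

end

noncomputable section

open ENNReal

/-- The closed ball of radius `ρ` around `x` in the torus metric. -/
def torusBall (d : ℕ) (x : Euc d) (ρ : ℝ) : Set (Euc d) := {y | torusDist d x y ≤ ρ}

/-- `ln²(M + 1)` for `M ∈ [0,∞]`, valued in `[0,∞]` (equal to `∞` when `M = ∞`). -/
def lnSqE (M : ℝ≥0∞) : ℝ≥0∞ :=
  if M = ∞ then ∞ else ENNReal.ofReal (Real.log (M.toReal + 1) ^ 2)

/-- The maximal function `M(x) = sup_{0 < ρ ≤ 1/2} λ(B(x,ρ))/μ(B(x,ρ))`, where `B(x,ρ)`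
is the torus ball, `λ` is Lebesgue measure on the torus and `μ` the measure with density `f`. -/
def maximalLambdaOverMu (d : ℕ) (f : Euc d → ℝ) (x : Euc d) : ℝ≥0∞ :=
  ⨆ ρ ∈ Set.Ioc (0 : ℝ) (1/2 : ℝ),
    (volume.restrict (unitCube d)) (torusBall d x ρ) / densityMeasure d f (torusBall d x ρ)

/-- Maximal inequality along a refining sequence of countable partitions. -/
theorem measure_exists_le_of_refining {α ι : Type*} [MeasurableSpace α] [Countable ι]
    [MeasurableSpace ι] [MeasurableSingletonClass ι] (μ ν : Measure α) (t : ℝ≥0∞)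
    (p : ℕ → α → ι) (hp : ∀ k, Measurable (p k))
    (href : ∀ j k, j ≤ k → ∀ x y, p k x = p k y → p j x = p j y) :
    MeasurableSet {x | ∃ k, t * μ (p k ⁻¹' {p k x}) ≤ ν (p k ⁻¹' {p k x})} ∧
    t * μ {x | ∃ k, t * μ (p k ⁻¹' {p k x}) ≤ ν (p k ⁻¹' {p k x})} ≤ ν Set.univ := by
  set bad : ℕ → Set α := fun k => {x | t * μ (p k ⁻¹' {p k x}) ≤ ν (p k ⁻¹' {p k x})} with hbad
  have bad_congr : ∀ k x y, p k x = p k y → (x ∈ bad k ↔ y ∈ bad k) := by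
    intro k x y h
    simp only [hbad, Set.mem_ofPred_eq, h]
  have hmeas : ∀ k, MeasurableSet (bad k) := by
    intro k
    exact (hp k) (Set.to_countable {i | t * μ (p k ⁻¹' {i}) ≤ ν (p k ⁻¹' {i})}).measurableSet
  have hmeas' : ∀ k, MeasurableSet (disjointed bad k) := fun k =>
    MeasurableSet.disjointed hmeas k
  have first_congr : ∀ k x y, p k x = p k y →
      x ∈ disjointed bad k → y ∈ disjointed bad k := by
    intro k x y h hx
    rw [disjointed_eq_inter_compl] at hx ⊢
    simp only [Set.mem_inter_iff, Set.mem_iInter, Set.mem_compl_iff] at hx ⊢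
    exact ⟨(bad_congr k x y h).1 hx.1, fun j hj hy =>
      hx.2 j hj ((bad_congr j x y (href j k hj.le x y h)).2 hy)⟩
  have hunion : {x | ∃ k, t * μ (p k ⁻¹' {p k x}) ≤ ν (p k ⁻¹' {p k x})}
      = ⋃ k, disjointed bad k := by
    rw [iUnion_disjointed]
    ext x
    simp [hbad]
  have hfirst : ∀ k, t * μ (disjointed bad k) ≤ ν (disjointed bad k) := by
    intro k
    have hdec : disjointed bad k = ⋃ i, (disjointed bad k ∩ p k ⁻¹' {i}) := by
      ext x; simp
    have hdisj : Pairwise (Function.onFun Disjoint fun i => disjointed bad k ∩ p k ⁻¹' {i}) := by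
      intro i j hij
      refine Set.disjoint_left.2 fun x hx hy => hij ?_
      exact hx.2.symm.trans hy.2
    have hm : ∀ i, MeasurableSet (disjointed bad k ∩ p k ⁻¹' {i}) := fun i =>
      (hmeas' k).inter (hp k (measurableSet_singleton i))
    rw [hdec, measure_iUnion hdisj hm, measure_iUnion hdisj hm, ← ENNReal.tsum_mul_left]
    refine ENNReal.tsum_le_tsum fun i => ?_
    rcases (disjointed bad k ∩ p k ⁻¹' {i}).eq_empty_or_nonempty with h | ⟨x, hx, hxi⟩
    · simp [h]
    · have hxi : p k x = i := hxi
      have : disjointed bad k ∩ p k ⁻¹' {i} = p k ⁻¹' {p k x} := by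
        ext y
        refine ⟨fun hy => hy.2.trans hxi.symm, fun hy => ⟨?_, hy.trans hxi⟩⟩
        exact first_congr k x y hy.symm hx
      rw [this]
      exact disjointed_subset bad k hx
  rw [hunion]
  refine ⟨MeasurableSet.iUnion hmeas', ?_⟩
  rw [measure_iUnion (disjoint_disjointed bad) hmeas', ← ENNReal.tsum_mul_left]
  calc ∑' k, t * μ (disjointed bad k) ≤ ∑' k, ν (disjointed bad k) :=
        ENNReal.tsum_le_tsum hfirst
    _ = ν (⋃ k, disjointed bad k) := (measure_iUnion (disjoint_disjointed bad) hmeas').symm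
    _ ≤ ν Set.univ := measure_mono (Set.subset_univ _)

theorem lnSqE_mono {a b : ℝ≥0∞} (h : a ≤ b) : lnSqE a ≤ lnSqE b := by
  unfold lnSqE
  by_cases hb : b = ∞
  · simp [hb]
  · have ha : a ≠ ∞ := ne_top_of_le_ne_top hb h
    simp only [ha, hb, if_false]
    have h0 : 0 ≤ a.toReal := ENNReal.toReal_nonneg
    have h1 : a.toReal ≤ b.toReal := ENNReal.toReal_mono hb h
    have h2 : 0 ≤ Real.log (a.toReal + 1) := Real.log_nonneg (by linarith)
    gcongr

theorem lnSqE_two_pow_le (n : ℕ) : lnSqE (2 ^ n) ≤ ((n + 1 : ℕ) : ℝ≥0∞) ^ 2 := by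
  have h : (2 : ℝ≥0∞) ^ n ≠ ∞ := by simp
  have h1 : Real.log ((2 : ℝ) ^ n + 1) ≤ (n + 1 : ℕ) := by
    have h2 : (2 : ℝ) ^ n + 1 ≤ 2 ^ (n + 1) := by
      have : (1 : ℝ) ≤ 2 ^ n := one_le_pow₀ (by norm_num)
      rw [pow_succ]; linarith
    calc Real.log ((2 : ℝ) ^ n + 1) ≤ Real.log (2 ^ (n + 1)) :=
          Real.log_le_log (by positivity) h2
      _ = (n + 1 : ℕ) * Real.log 2 := Real.log_pow _ _
      _ ≤ (n + 1 : ℕ) * 1 := by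
          gcongr
          have := Real.log_two_lt_d9
          linarith
      _ = _ := mul_one _
  have h0 : 0 ≤ Real.log ((2 : ℝ) ^ n + 1) := Real.log_nonneg (by
    have : (0 : ℝ) ≤ 2 ^ n := by positivity
    linarith)
  rw [lnSqE, if_neg h]
  simp only [ENNReal.toReal_pow, ENNReal.toReal_ofNat]
  rw [ENNReal.ofReal_pow h0]
  gcongr
  exact (ENNReal.ofReal_le_ofReal h1).trans_eq (ENNReal.ofReal_natCast _)

theorem lnSqE_le_tsum_indicator {α : Type*} (A : ℕ → Set α) (M : ℝ≥0∞) (x : α)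
    (hA : ∀ n : ℕ, (2 : ℝ≥0∞) ^ n < M → x ∈ A n) :
    lnSqE M ≤ 1 + ∑' n : ℕ, (A n).indicator (fun _ => ((n + 2 : ℕ) : ℝ≥0∞) ^ 2) x := by
  by_cases hM : M = ∞
  · have : ∑' n : ℕ, (A n).indicator (fun _ => ((n + 2 : ℕ) : ℝ≥0∞) ^ 2) x = ∞ := by
      rw [eq_top_iff, ← ENNReal.tsum_const_eq_top_of_ne_zero (α := ℕ) one_ne_zero]
      refine ENNReal.tsum_le_tsum fun n => ?_
      rw [Set.indicator_of_mem (hA n (by simp [hM, lt_top_iff_ne_top]))]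
      exact one_le_pow₀ (by exact_mod_cast (by omega : 1 ≤ n + 2))
    rw [this, add_top]
    exact le_top
  · obtain ⟨N, hN⟩ : ∃ n : ℕ, M ≤ 2 ^ n := by
      obtain ⟨n, hn⟩ := ENNReal.exists_nat_gt hM
      refine ⟨n, hn.le.trans ?_⟩
      exact_mod_cast Nat.lt_two_pow_self.le
    classical
    have hex : ∃ n : ℕ, M ≤ 2 ^ n := ⟨N, hN⟩
    have hspec := Nat.find_spec hex
    rcases hm : Nat.find hex with _ | m
    · rw [hm] at hspec
      refine ((lnSqE_mono hspec).trans (lnSqE_two_pow_le 0)).trans ?_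
      simp
    · have hlt : (2 : ℝ≥0∞) ^ m < M := not_le.1 (Nat.find_min hex (by omega))
      rw [hm] at hspec
      refine ((lnSqE_mono hspec).trans (lnSqE_two_pow_le (m + 1))).trans ?_
      refine le_trans ?_ (le_trans (ENNReal.le_tsum m) le_add_self)
      rw [Set.indicator_of_mem (hA m hlt)]

theorem lintegral_lnSqE_le {α : Type*} [MeasurableSpace α] (μ : Measure α)
    [IsProbabilityMeasure μ] (M : α → ℝ≥0∞) (A : ℕ → Set α) (K : ℝ≥0∞)
    (hmeas : ∀ n, MeasurableSet (A n)) (hM : ∀ᵐ x ∂μ, ∀ n : ℕ, (2 : ℝ≥0∞) ^ n < M x → x ∈ A n)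
    (hA : ∀ n : ℕ, 2 ^ n * μ (A n) ≤ K) :
    ∫⁻ x, lnSqE (M x) ∂μ ≤ 1 + K * ∑' n : ℕ, ((n + 2 : ℕ) : ℝ≥0∞) ^ 2 * (2 ^ n)⁻¹ := by
  calc ∫⁻ x, lnSqE (M x) ∂μ
      ≤ ∫⁻ x, 1 + ∑' n : ℕ, (A n).indicator (fun _ => ((n + 2 : ℕ) : ℝ≥0∞) ^ 2) x ∂μ :=
        lintegral_mono_ae (hM.mono fun x hx => lnSqE_le_tsum_indicator A (M x) x hx)
    _ = 1 + ∑' n : ℕ, ((n + 2 : ℕ) : ℝ≥0∞) ^ 2 * μ (A n) := by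
        rw [lintegral_add_left measurable_const, lintegral_const, measure_univ, one_mul,
          lintegral_tsum fun n => (measurable_const.indicator (hmeas n)).aemeasurable]
        simp only [lintegral_indicator_const (hmeas _)]
    _ ≤ _ := by
        rw [← ENNReal.tsum_mul_left]
        refine add_le_add_right (ENNReal.tsum_le_tsum fun n => ?_) 1
        have : μ (A n) ≤ K * (2 ^ n)⁻¹ := by
          rw [← div_eq_mul_inv, ENNReal.le_div_iff_mul_le (by simp) (by simp), mul_comm]
          exact hA n
        calc _ ≤ ((n + 2 : ℕ) : ℝ≥0∞) ^ 2 * (K * (2 ^ n)⁻¹) := by gcongr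
          _ = _ := by ring

theorem tsum_sq_mul_two_pow_inv_ne_top :
    ∑' n : ℕ, ((n + 2 : ℕ) : ℝ≥0∞) ^ 2 * (2 ^ n)⁻¹ ≠ ∞ := by
  have hs : Summable fun n : ℕ => ((n + 2 : ℕ) : ℝ) ^ 2 * (1 / 2) ^ (n + 2) :=
    (summable_nat_add_iff 2).2
      (summable_pow_mul_geometric_of_norm_lt_one (R := ℝ) 2 (by norm_num : ‖(1 / 2 : ℝ)‖ < 1))
  have hs' : Summable fun n : ℕ => ((n + 2 : ℕ) : ℝ) ^ 2 * (2 ^ n)⁻¹ := by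
    refine (hs.mul_left 4).congr fun n => ?_
    rw [pow_add, one_div, inv_pow]
    ring
  convert hs'.tsum_ofReal_ne_top using 4 with n
  rw [ENNReal.ofReal_mul (by positivity), ENNReal.ofReal_pow (by positivity),
    ENNReal.ofReal_natCast, ENNReal.ofReal_inv_of_pos (by positivity),
    ENNReal.ofReal_pow (by positivity), ENNReal.ofReal_ofNat]

/-- The index of the dyadic cube of side `2⁻ᵏ` containing `x`. -/
def dyadicIndex (d k : ℕ) (x : Euc d) : Fin d → ℤ := fun i => ⌊2 ^ k * x i⌋

theorem measurable_dyadicIndex (d k : ℕ) : Measurable (dyadicIndex d k) := by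
  refine measurable_pi_lambda _ fun i => Int.measurable_floor.comp ?_
  fun_prop

theorem dyadicIndex_eq_of_le {d j k : ℕ} (hjk : j ≤ k) {x y : Euc d}
    (h : dyadicIndex d k x = dyadicIndex d k y) : dyadicIndex d j x = dyadicIndex d j y := by
  ext i
  have hdiv : ∀ z : ℝ, ⌊2 ^ j * z⌋ = ⌊2 ^ k * z⌋ / (2 ^ (k - j) : ℕ) := by
    intro z
    rw [← Int.floor_div_natCast]
    congr 1
    rw [_root_.eq_div_iff (by positivity)]
    push_cast
    rw [mul_right_comm, ← pow_add, Nat.add_sub_cancel' hjk]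
  have := congrFun h i
  simp only [dyadicIndex] at this ⊢
  rw [hdiv, hdiv, this]

theorem volume_box (d : ℕ) (a b : Fin d → ℝ) :
    volume {x : Euc d | ∀ i, x i ∈ Set.Ico (a i) (b i)} = ∏ i, ENNReal.ofReal (b i - a i) := by
  rw [← Real.volume_pi_Ico, ← (PiLp.volume_preserving_ofLp (Fin d)).measure_preimage
    (MeasurableSet.univ_pi fun _ => measurableSet_Ico).nullMeasurableSet]
  congr 1
  ext x
  simp only [Set.mem_preimage, Set.mem_univ_pi, Set.mem_ofPred_eq]

theorem mem_dyadicCube_iff {d k : ℕ} (n : Fin d → ℤ) (x : Euc d) :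
    dyadicIndex d k x = n ↔ ∀ i, x i ∈ Set.Ico (n i * (1 / 2 : ℝ) ^ k) ((n i + 1) * (1 / 2) ^ k) := by
  rw [funext_iff]
  refine forall_congr' fun i => ?_
  have h2 : (0 : ℝ) < 2 ^ k := by positivity
  rw [dyadicIndex, Int.floor_eq_iff, Set.mem_Ico, one_div, inv_pow, ← div_eq_mul_inv,
    ← div_eq_mul_inv, _root_.div_le_iff₀ h2, _root_.lt_div_iff₀ h2,
    mul_comm]

theorem volume_dyadicCube (d k : ℕ) (n : Fin d → ℤ) :
    volume (dyadicIndex d k ⁻¹' {n}) = ENNReal.ofReal (((1 / 2 : ℝ) ^ k) ^ d) := by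
  have : dyadicIndex d k ⁻¹' {n} =
      {x | ∀ i, x i ∈ Set.Ico (n i * (1 / 2 : ℝ) ^ k) ((n i + 1) * (1 / 2) ^ k)} := by
    ext x
    exact mem_dyadicCube_iff n x
  rw [this, volume_box]
  have h : ∀ i, ((n i + 1) * (1 / 2 : ℝ) ^ k - n i * (1 / 2) ^ k) = (1 / 2) ^ k := fun i => by ring
  simp only [h, Finset.prod_const, Finset.card_univ, Fintype.card_fin]
  exact (ENNReal.ofReal_pow (by positivity) d).symm

theorem abs_sub_lt_of_dyadicIndex_eq {d k : ℕ} {x y : Euc d}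
    (h : dyadicIndex d k x = dyadicIndex d k y) (i : Fin d) : |x i - y i| < (1 / 2) ^ k := by
  have hx := (mem_dyadicCube_iff _ x).1 h i
  have hy := (mem_dyadicCube_iff (dyadicIndex d k y) y).1 rfl i
  rw [abs_sub_lt_iff]
  constructor <;> linarith [hx.1, hx.2, hy.1, hy.2]

theorem torusDist_le_norm_sub (d : ℕ) (x y : Euc d) : torusDist d x y ≤ ‖x - y‖ := by
  have h0 : intVec d 0 = 0 := by
    ext i
    simp [intVec]
  have := ciInf_le (f := fun m : Fin d → ℤ => ‖x + intVec d m - y‖)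
    ⟨0, by rintro _ ⟨m, rfl⟩; exact norm_nonneg _⟩ 0
  simpa [h0, torusDist] using this

theorem dyadicCube_subset_torusBall {d k : ℕ} {ρ : ℝ} (hρ : d * (1 / 2) ^ k ≤ ρ) (x : Euc d) :
    dyadicIndex d k ⁻¹' {dyadicIndex d k x} ⊆ torusBall d x ρ := by
  intro y hy
  refine ((torusDist_le_norm_sub d x y).trans ?_).trans hρ
  have hd : (d : ℝ) ≤ d ^ 2 := by
    exact_mod_cast Nat.le_self_pow two_ne_zero d
  rw [EuclideanSpace.norm_eq]
  refine Real.sqrt_le_iff.2 ⟨by positivity, ?_⟩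
  calc ∑ i, ‖(x - y) i‖ ^ 2 ≤ ∑ _i : Fin d, ((1 / 2 : ℝ) ^ k) ^ 2 := by
        gcongr with i
        exact (abs_sub_lt_of_dyadicIndex_eq (Eq.symm hy) i).le
    _ = d * ((1 / 2 : ℝ) ^ k) ^ 2 := by simp
    _ ≤ d ^ 2 * ((1 / 2 : ℝ) ^ k) ^ 2 := by gcongr
    _ = _ := by ring

theorem volume_torusBall_inter_unitCube_le {d : ℕ} {x : Euc d} (hx : x ∈ unitCube d) {ρ : ℝ}
    (hρ : ρ ∈ Set.Ioc (0 : ℝ) (1 / 2)) :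
    volume (torusBall d x ρ ∩ unitCube d) ≤
      3 ^ d * (ENNReal.ofReal ((2 * ρ) ^ d) * volume (Metric.ball (0 : Euc d) 1)) := by
  have hsub : torusBall d x ρ ∩ unitCube d ⊆
      ⋃ m ∈ Fintype.piFinset fun _ : Fin d => Finset.Icc (-1 : ℤ) 1,
        Metric.closedBall (x + intVec d m) (2 * ρ) := by
    rintro y ⟨hy, hyc⟩
    have hlt : torusDist d x y < 2 * ρ := lt_of_le_of_lt hy (by linarith [hρ.1])
    obtain ⟨m, hm⟩ := exists_lt_of_ciInf_lt hlt
    simp only [Set.mem_iUnion]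
    refine ⟨m, Fintype.mem_piFinset.2 fun i => ?_, ?_⟩
    · have h1 : |x i + m i - y i| < 1 := by
        have := PiLp.norm_apply_le (x + intVec d m - y) i
        simp only [intVec, Real.norm_eq_abs] at this
        refine lt_of_le_of_lt this (hm.trans_le ?_)
        linarith [hρ.2]
      rw [abs_lt] at h1
      have h2 : (-2 : ℝ) < m i := by linarith [(hx i).2, (hyc i).1]
      have h3 : (m i : ℝ) < 2 := by linarith [(hx i).1, (hyc i).2]
      have h2' : (-2 : ℤ) < m i := by exact_mod_cast h2
      have h3' : m i < 2 := by exact_mod_cast h3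
      rw [Finset.mem_Icc]
      omega
    · rw [Metric.mem_closedBall, dist_comm, dist_eq_norm]
      exact hm.le
  refine (measure_mono hsub).trans ((measure_biUnion_finset_le _ _).trans ?_)
  have hvol : ∀ m : Fin d → ℤ, volume (Metric.closedBall (x + intVec d m) (2 * ρ)) =
      ENNReal.ofReal ((2 * ρ) ^ d) * volume (Metric.ball (0 : Euc d) 1) := by
    intro m
    rw [Measure.addHaar_closedBall _ _ (by linarith [hρ.1]), finrank_euclideanSpace_fin]
  simp only [hvol, Finset.sum_const, nsmul_eq_mul, Fintype.card_piFinset_const]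
  simp

theorem exists_dyadic_scale {d : ℕ} (hd : 1 ≤ d) {ρ : ℝ} (hρ : ρ ∈ Set.Ioc (0 : ℝ) (1 / 2)) :
    ∃ k : ℕ, d * (1 / 2 : ℝ) ^ k ≤ ρ ∧ ρ ≤ 2 * d * (1 / 2) ^ k := by
  have hd' : (1 : ℝ) ≤ d := by exact_mod_cast hd
  have hd0 : (0 : ℝ) < d := by linarith
  obtain ⟨k, hk, hk'⟩ := exists_nat_pow_near_of_lt_one (x := ρ / d) (y := (1 / 2 : ℝ))
    (div_pos hρ.1 hd0) (by rw [div_le_one hd0]; linarith [hρ.2]) (by norm_num) (by norm_num)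
  rw [lt_div_iff₀ hd0] at hk
  rw [div_le_iff₀ hd0] at hk'
  refine ⟨k + 1, by linarith, ?_⟩
  rw [pow_succ]
  linarith

theorem measurableSet_unitCube (d : ℕ) : MeasurableSet (unitCube d) := by
  have : unitCube d = ⋂ i, (fun x : Euc d => x i) ⁻¹' Set.Icc 0 1 := by
    ext; simp [unitCube]
  rw [this]
  exact MeasurableSet.iInter fun i => measurableSet_Icc.preimage (by fun_prop)

/-- Comparison of the maximal function with its dyadic analogue. -/
theorem exists_dyadic_of_lt_maximalLambdaOverMu {d : ℕ} (hd : 1 ≤ d) {f : Euc d → ℝ}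
    {x : Euc d} (hx : x ∈ unitCube d) {t : ℝ≥0∞} (ht : t < maximalLambdaOverMu d f x) :
    ∃ k, t * densityMeasure d f (dyadicIndex d k ⁻¹' {dyadicIndex d k x}) ≤
      3 ^ d * ENNReal.ofReal ((4 * d) ^ d) * volume (Metric.ball (0 : Euc d) 1) *
        volume (dyadicIndex d k ⁻¹' {dyadicIndex d k x}) := by
  simp only [maximalLambdaOverMu, lt_iSup_iff] at ht
  obtain ⟨ρ, hρ, ht⟩ := ht
  obtain ⟨k, hk, hk'⟩ := exists_dyadic_scale hd hρ
  refine ⟨k, ?_⟩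
  calc t * densityMeasure d f (dyadicIndex d k ⁻¹' {dyadicIndex d k x})
      ≤ t * densityMeasure d f (torusBall d x ρ) := by
        gcongr
        exact dyadicCube_subset_torusBall hk x
    _ ≤ volume.restrict (unitCube d) (torusBall d x ρ) := (ENNReal.mul_lt_of_lt_div ht).le
    _ = volume (torusBall d x ρ ∩ unitCube d) := Measure.restrict_apply' (measurableSet_unitCube d)
    _ ≤ 3 ^ d * (ENNReal.ofReal ((2 * ρ) ^ d) * volume (Metric.ball (0 : Euc d) 1)) :=
        volume_torusBall_inter_unitCube_le hx hρ
    _ ≤ 3 ^ d * (ENNReal.ofReal ((4 * d) ^ d * ((1 / 2 : ℝ) ^ k) ^ d) *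
          volume (Metric.ball (0 : Euc d) 1)) := by
        rw [← mul_pow]
        have hle : 2 * ρ ≤ 4 * d * (1 / 2 : ℝ) ^ k := by linarith
        have := hρ.1
        gcongr
    _ = _ := by
        rw [volume_dyadicCube, ENNReal.ofReal_mul (by positivity)]
        ring

theorem dyadicCube_subset_box {d : ℕ} {x : Euc d} (hx : x ∈ unitCube d) (k : ℕ) :
    dyadicIndex d k ⁻¹' {dyadicIndex d k x} ⊆ {y | ∀ i, y i ∈ Set.Ico (-1 : ℝ) 2} := by
  intro y hy i
  have h := (abs_sub_lt_of_dyadicIndex_eq hy i).trans_le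
    (pow_le_one₀ (by norm_num) (by norm_num))
  rw [abs_sub_lt_iff] at h
  constructor <;> linarith [(hx i).1, (hx i).2, h.1, h.2]

/-- `∫_{[0,1]^d} ln²(M(x)+1) f(x) dx ≤ C` with `C` depending only on `d`,
for every probability density `f` on the torus. -/
theorem lintegral_sq_log_maximal_le (d : ℕ) (hd : 1 ≤ d) :
    ∃ C : ℝ, 0 < C ∧ ∀ f : Euc d → ℝ, Measurable f → (∀ x, 0 ≤ f x) →
      IsPeriodic d f → (∫ x in unitCube d, f x) = 1 →
      (∫⁻ x in unitCube d, ENNReal.ofReal (f x) * lnSqE (maximalLambdaOverMu d f x))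
        ≤ ENNReal.ofReal C := by
  set c : ℝ≥0∞ := 3 ^ d * ENNReal.ofReal ((4 * d) ^ d) * volume (Metric.ball (0 : Euc d) 1)
    with hc
  set box : Set (Euc d) := {y | ∀ i, y i ∈ Set.Ico (-1 : ℝ) 2} with hbox
  set S : ℝ≥0∞ := ∑' n : ℕ, ((n + 2 : ℕ) : ℝ≥0∞) ^ 2 * (2 ^ n)⁻¹ with hS
  have hc_top : c ≠ ∞ := by
    refine ENNReal.mul_ne_top (ENNReal.mul_ne_top (by simp) ENNReal.ofReal_ne_top) ?_
    exact measure_ball_lt_top.ne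
  have hbox_top : volume box ≠ ∞ := by
    rw [hbox, volume_box d (fun _ => -1) (fun _ => 2)]
    exact ENNReal.prod_ne_top fun i _ => ENNReal.ofReal_ne_top
  have htop : 1 + c * volume box * S ≠ ∞ :=
    ENNReal.add_ne_top.2 ⟨ENNReal.one_ne_top, ENNReal.mul_ne_top
      (ENNReal.mul_ne_top hc_top hbox_top) tsum_sq_mul_two_pow_inv_ne_top⟩
  refine ⟨(1 + c * volume box * S).toReal, ENNReal.toReal_pos (by simp) htop, ?_⟩
  intro f hf hf0 _ hf1
  rw [ENNReal.ofReal_toReal htop]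
  have hprob : IsProbabilityMeasure (densityMeasure d f) := by
    refine ⟨?_⟩
    have hint : Integrable f (volume.restrict (unitCube d)) := by
      by_contra h
      rw [integral_undef h] at hf1
      exact zero_ne_one hf1
    rw [densityMeasure, withDensity_apply _ MeasurableSet.univ, Measure.restrict_univ,
      ← ofReal_integral_eq_lintegral_ofReal hint (Filter.Eventually.of_forall hf0), hf1,
      ENNReal.ofReal_one]
  have hcube : ∀ᵐ x ∂densityMeasure d f, x ∈ unitCube d :=
    (withDensity_absolutelyContinuous _ _).ae_le (ae_restrict_mem (measurableSet_unitCube d))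
  have hmax := fun n : ℕ => measure_exists_le_of_refining (densityMeasure d f)
    (c • volume.restrict box) (2 ^ n) (dyadicIndex d) (measurable_dyadicIndex d)
    (fun j k hjk x y => dyadicIndex_eq_of_le hjk)
  have key := lintegral_lnSqE_le (densityMeasure d f) (maximalLambdaOverMu d f) _
    (c * volume box) (fun n => (hmax n).1) ?_ fun n => (hmax n).2.trans_eq (by simp)
  · rwa [densityMeasure, lintegral_withDensity_eq_lintegral_mul_non_measurable _ (by fun_prop)
      (Filter.Eventually.of_forall fun x => ENNReal.ofReal_lt_top)] at key
  · filter_upwards [hcube] with x hx n hn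
    obtain ⟨k, hk⟩ := exists_dyadic_of_lt_maximalLambdaOverMu hd hx hn
    refine ⟨k, hk.trans_eq ?_⟩
    rw [Measure.smul_apply, smul_eq_mul, Measure.restrict_apply
      (measurable_dyadicIndex d k (measurableSet_singleton _)),
      Set.inter_eq_left.2 (dyadicCube_subset_box hx k)]

end
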